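/- Assume α, β, γ are positive irrational numbers with α + β + γ = 1, β < 1/2 and α < γ, and let W̃_γ, E_γ, c, c̃ be as defined in the context. For n ∈ ℕ put m = c̃(n). Then c(n) − c̃(n) ∈ {−1, 0, 1}, and: c(n) − c̃(n) = −1 if and only if m ∈ W̃_γ and (E_γ(m) = −1 or (E_γ(m) = 0 and m ∉ W_γ)); c(n) − c̃(n) = 0 if and only if m ∈ W̃_γ and E_γ(m) = 0 and m ∈ W_γ; and c(n) − c̃(n) = 1 if and only if m ∈ W̃_γ and E_γ(m) = 1. -/

import Mathlib

/-- The `n`-th term of the Webster sequence of density `d`: `⌈(n - 1/2)/d⌉`. -/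
noncomputable def wTerm (d : ℝ) (n : ℕ) : ℕ := ⌈((n : ℝ) - 1/2) / d⌉₊

/-- The Webster sequence of density `d`, as a set of positive integers. -/
def wSet (d : ℝ) : Set ℕ := {m : ℕ | ∃ n : ℕ, 1 ≤ n ∧ m = wTerm d n}

/-- Counting function of a set of positive integers: `S(m) = #{k ∈ S : k ≤ m}`. -/
noncomputable def wCount (S : Set ℕ) (m : ℕ) : ℕ := (S ∩ Set.Iic m).ncard

/-- `u_n = {nd + 1/2}` (fractional part), for density `d`. -/
noncomputable def fpart (d : ℝ) (n : ℕ) : ℝ := Int.fract ((n : ℝ) * d + 1/2)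

/-- The set `W̃_α` of Algorithm 2. -/
def WtA (α : ℝ) : Set ℕ := {n : ℕ | 1 ≤ n ∧ fpart α n < α}

/-- The set `W̃_β` of Algorithm 2. -/
def WtB (α β : ℝ) : Set ℕ := {n : ℕ | 1 ≤ n ∧
  ((α < fpart α n ∧ fpart β n < β) ∨
   (1 - α < fpart α n ∧ 1 - β/2 < fpart β n) ∨
   (α < fpart α n ∧ fpart α n < 2*α ∧ β < fpart β n ∧ fpart β n < 3*β/2))}

/-- The set `W̃_γ` of Algorithm 2. -/
def WtC (α β : ℝ) : Set ℕ := {n : ℕ | 1 ≤ n} \ (WtA α ∪ WtB α β)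

/-- `E_γ(n) = W̃_γ(n) − W_γ(n)`. -/
noncomputable def Egamma (α β γ : ℝ) (n : ℕ) : ℤ :=
  (wCount (WtC α β) n : ℤ) - (wCount (wSet γ) n : ℤ)

/-- The `n`-th smallest element (1-indexed) of a set of naturals. -/
noncomputable def nthElt (S : Set ℕ) (n : ℕ) : ℕ := Nat.nth (· ∈ S) (n - 1)

/-- The Webster counting function in closed form. -/
noncomputable def websterFloor (d : ℝ) (m : ℕ) : ℤ := ⌊(m : ℝ) * d + 1 / 2⌋

lemma fpart_eq (d : ℝ) (m : ℕ) : fpart d m = m * d + 1 / 2 - websterFloor d m := rfl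

lemma fpart_nonneg (d : ℝ) (m : ℕ) : 0 ≤ fpart d m := Int.fract_nonneg _

lemma fpart_lt_one (d : ℝ) (m : ℕ) : fpart d m < 1 := Int.fract_lt_one _

lemma websterFloor_zero (d : ℝ) : websterFloor d 0 = 0 := by
  norm_num [websterFloor, Int.floor_eq_iff]

lemma websterFloor_mono {d : ℝ} (hd : 0 < d) : Monotone (websterFloor d) := by
  intro a b hab
  unfold websterFloor
  gcongr

lemma websterFloor_succ {d : ℝ} (hd : 0 < d) (hd1 : d < 1) (m : ℕ) :
    (websterFloor d (m + 1) = websterFloor d m ∧ fpart d (m + 1) = fpart d m + d) ∨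
    (websterFloor d (m + 1) = websterFloor d m + 1 ∧ fpart d (m + 1) = fpart d m + d - 1) := by
  have h0 := fpart_nonneg d m
  have h1 := fpart_lt_one d m
  have h2 := fpart_nonneg d (m + 1)
  have h3 := fpart_lt_one d (m + 1)
  have e := fpart_eq d m
  have e' := fpart_eq d (m + 1)
  push_cast at e'
  have hlo : websterFloor d m < websterFloor d (m + 1) + 1 := by
    rify; linarith
  have hhi : websterFloor d (m + 1) < websterFloor d m + 2 := by
    rify; linarith
  rcases (by omega : websterFloor d (m + 1) = websterFloor d m ∨
    websterFloor d (m + 1) = websterFloor d m + 1) with h | h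
  · refine Or.inl ⟨h, ?_⟩
    rw [h] at e'; linarith
  · refine Or.inr ⟨h, ?_⟩
    rw [h] at e'; push_cast at e'; linarith

lemma wTerm_eq_succ_iff {d : ℝ} (hd : 0 < d) (n k : ℕ) :
    wTerm d n = k + 1 ↔ websterFloor d k < n ∧ (n : ℤ) ≤ websterFloor d (k + 1) := by
  unfold wTerm websterFloor
  rw [Nat.ceil_eq_iff (by omega), Int.floor_lt, Int.le_floor, lt_div_iff₀ hd, div_le_iff₀ hd]
  push_cast [Nat.add_sub_cancel]
  constructor <;> rintro ⟨h1, h2⟩ <;> constructor <;> linarith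

lemma succ_mem_wSet_iff {d : ℝ} (hd : 0 < d) (hd1 : d < 1) (k : ℕ) :
    k + 1 ∈ wSet d ↔ websterFloor d (k + 1) = websterFloor d k + 1 := by
  have h0 : 0 ≤ websterFloor d k := websterFloor_zero d ▸ websterFloor_mono hd (Nat.zero_le k)
  constructor
  · rintro ⟨n, -, hn⟩
    have := (wTerm_eq_succ_iff hd n k).1 hn.symm
    rcases websterFloor_succ hd hd1 k with h | h <;> omega
  · intro h
    refine ⟨(websterFloor d k + 1).toNat, by omega, ((wTerm_eq_succ_iff hd _ k).2 ?_).symm⟩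
    omega

lemma zero_notMem_wSet {d : ℝ} (hd : 0 < d) : 0 ∉ wSet d := by
  rintro ⟨n, hn, h⟩
  have h' : (1 : ℝ) ≤ n := by exact_mod_cast hn
  have : 0 < wTerm d n := Nat.ceil_pos.2 (div_pos (by linarith) hd)
  omega

open Classical in
lemma wCount_eq_count (S : Set ℕ) (m : ℕ) : wCount S m = Nat.count (· ∈ S) (m + 1) := by
  rw [Nat.count_eq_card_filter_range, ← Set.ncard_coe_finset]
  unfold wCount
  congr 1
  ext k
  simp [and_comm]

open Classical in
lemma wCount_succ (S : Set ℕ) (m : ℕ) :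
    wCount S (m + 1) = wCount S m + if m + 1 ∈ S then 1 else 0 := by
  rw [wCount_eq_count, wCount_eq_count, Nat.count_succ]

lemma wCount_zero {S : Set ℕ} (h : 0 ∉ S) : wCount S 0 = 0 := by
  classical
  rw [wCount_eq_count, Nat.count_succ]
  simp [h]

lemma wCount_wSet {d : ℝ} (hd : 0 < d) (hd1 : d < 1) (m : ℕ) :
    (wCount (wSet d) m : ℤ) = websterFloor d m := by
  induction m with
  | zero => simp [wCount_zero (zero_notMem_wSet hd), websterFloor_zero]
  | succ k ih =>
    rw [wCount_succ]
    have := succ_mem_wSet_iff hd hd1 k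
    rcases websterFloor_succ hd hd1 k with h | h <;> split_ifs <;> push_cast <;> grind

lemma zero_notMem_WtC (α β : ℝ) : 0 ∉ WtC α β := fun h => absurd h.1 (by simp)

lemma Irrational.int_mul_ne_odd {x : ℝ} (hx : Irrational x) (k l : ℤ) :
    (k : ℝ) * x ≠ 2 * l + 1 := by
  intro h
  rcases eq_or_ne k 0 with rfl | hk
  · have : (0 : ℤ) = 2 * l + 1 := by exact_mod_cast (by simpa using h : (0 : ℝ) = 2 * l + 1)
    omega
  · exact (hx.intCast_mul hk).ne_int (2 * l + 1) (by push_cast; exact h)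

/-- The fractional parts `{nd + 1/2}` avoid all half-integer combinations `j d / 2 + l`. -/
lemma fpart_ne {d : ℝ} (hd : Irrational d) (n : ℕ) (j l : ℤ) :
    fpart d n ≠ j * d / 2 + l := by
  rw [fpart_eq]
  intro h
  refine hd.int_mul_ne_odd (2 * n - j) (websterFloor d n + l - 1) ?_
  push_cast
  linarith

open Classical in
/-- The discrepancy `W̃_β(m) - W_β(m)` as a function of `u_m` and `v_m`. -/
noncomputable def betaError (α β u v : ℝ) : ℤ :=
  (if 1 - α < u ∧ 1 - β / 2 < v then 1 else 0) - (if u < α ∧ v < β / 2 then 1 else 0)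

lemma wCount_WtC {α β : ℝ} (hα : 0 < α) (hβ : 0 < β) (hαi : Irrational α) (hβi : Irrational β)
    (hα2 : α < 1 / 2) (hβ2 : β < 1 / 2) (m : ℕ) :
    (wCount (WtC α β) m : ℤ) =
      m - websterFloor α m - websterFloor β m - betaError α β (fpart α m) (fpart β m) := by
  induction m with
  | zero =>
    rw [wCount_zero (zero_notMem_WtC α β), websterFloor_zero, websterFloor_zero, fpart_eq,
      fpart_eq, websterFloor_zero, websterFloor_zero, betaError, if_neg, if_neg]
    · simp
    · norm_num; intros; linarith
    · norm_num; intros; linarith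
  | succ k ih =>
    have hmem : k + 1 ∈ WtC α β ↔ ¬ (fpart α (k + 1) < α) ∧
        ¬ ((α < fpart α (k + 1) ∧ fpart β (k + 1) < β) ∨
          (1 - α < fpart α (k + 1) ∧ 1 - β/2 < fpart β (k + 1)) ∨
          (α < fpart α (k + 1) ∧ fpart α (k + 1) < 2*α ∧
            β < fpart β (k + 1) ∧ fpart β (k + 1) < 3*β/2)) := by
      simp only [WtC, WtA, WtB, Set.mem_sdiff, Set.mem_union, Set.mem_ofPred_eq,
        Nat.le_add_left, true_and, not_or]
    have nu0 := fpart_ne hαi (k + 1) 0 0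
    have nu1 := fpart_ne hαi (k + 1) 2 0
    have nu2 := fpart_ne hαi (k + 1) (-2) 1
    have nu3 := fpart_ne hαi (k + 1) 4 0
    have nv1 := fpart_ne hβi (k + 1) 2 0
    have nv2 := fpart_ne hβi (k + 1) (-1) 1
    have nv3 := fpart_ne hβi (k + 1) 3 0
    have nv4 := fpart_ne hβi (k + 1) 1 0
    have u0 := fpart_nonneg α k
    have u1 := fpart_lt_one α k
    have v0 := fpart_nonneg β k
    have v1 := fpart_lt_one β k
    have u0' := fpart_nonneg α (k + 1)
    have u1' := fpart_lt_one α (k + 1)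
    have v0' := fpart_nonneg β (k + 1)
    have v1' := fpart_lt_one β (k + 1)
    rw [wCount_succ, Nat.cast_add, ih]
    clear ih
    simp only [hmem, betaError]
    push_cast at *
    rcases websterFloor_succ hα (by linarith) k with ⟨hF, hu⟩ | ⟨hF, hu⟩ <;>
    rcases websterFloor_succ hβ (by linarith) k with ⟨hG, hv⟩ | ⟨hG, hv⟩ <;>
    rw [hF, hG] <;> clear hF hG hmem hαi hβi <;>
    generalize fpart α (k + 1) = u' at * <;>
    generalize fpart β (k + 1) = v' at * <;>
    generalize fpart α k = u at * <;>
    generalize fpart β k = v at * <;>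
    grind

lemma Egamma_eq {α β γ : ℝ} (hα : 0 < α) (hβ : 0 < β) (hγ : 0 < γ)
    (hαi : Irrational α) (hβi : Irrational β)
    (hsum : α + β + γ = 1) (hβhalf : β < 1 / 2) (hαγ : α < γ) (m : ℕ) :
    (Egamma α β γ m : ℝ) = fpart α m + fpart β m + fpart γ m - 3 / 2
      - betaError α β (fpart α m) (fpart β m) := by
  rw [Egamma, wCount_wSet hγ (by linarith),
    wCount_WtC hα hβ hαi hβi (by linarith) hβhalf]
  have e1 := fpart_eq α m
  have e2 := fpart_eq β m
  have e3 := fpart_eq γ m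
  have e4 : (m : ℝ) * α + m * β + m * γ = m := by rw [← mul_add, ← mul_add, hsum, mul_one]
  push_cast
  linarith

lemma Egamma_bounds {α β γ : ℝ} (hα : 0 < α) (hβ : 0 < β) (hγ : 0 < γ)
    (hαi : Irrational α) (hβi : Irrational β)
    (hsum : α + β + γ = 1) (hβhalf : β < 1 / 2) (hαγ : α < γ) (m : ℕ) :
    -1 ≤ Egamma α β γ m ∧ Egamma α β γ m ≤ 1 := by
  have h := Egamma_eq hα hβ hγ hαi hβi hsum hβhalf hαγ m
  have u0 := fpart_nonneg α m
  have u1 := fpart_lt_one α m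
  have v0 := fpart_nonneg β m
  have v1 := fpart_lt_one β m
  have w0 := fpart_nonneg γ m
  have w1 := fpart_lt_one γ m
  have hlo : (-2 : ℝ) < Egamma α β γ m := by
    unfold betaError at h; push_cast at h; split_ifs at h <;> linarith
  have hhi : (Egamma α β γ m : ℝ) < 2 := by
    unfold betaError at h; push_cast at h; split_ifs at h <;> linarith
  have hlo' : -2 < Egamma α β γ m := by exact_mod_cast hlo
  have hhi' : Egamma α β γ m < 2 := by exact_mod_cast hhi
  omega

lemma websterFloor_succ_of_Egamma_eq_one {α β γ : ℝ} (hα : 0 < α) (hβ : 0 < β) (hγ : 0 < γ)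
    (hαi : Irrational α) (hβi : Irrational β)
    (hsum : α + β + γ = 1) (hβhalf : β < 1 / 2) (hαγ : α < γ) {m : ℕ}
    (hE : Egamma α β γ m = 1) :
    websterFloor γ (m + 1) = websterFloor γ m + 1 := by
  have h := Egamma_eq hα hβ hγ hαi hβi hsum hβhalf hαγ m
  have u0 := fpart_nonneg α m
  have u1 := fpart_lt_one α m
  have v0 := fpart_nonneg β m
  have v1 := fpart_lt_one β m
  have w1 := fpart_lt_one γ m
  have w1' := fpart_lt_one γ (m + 1)
  rcases websterFloor_succ hγ (by linarith) m with ⟨-, hw⟩ | ⟨hF, -⟩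
  · rw [hE] at h
    unfold betaError at h
    push_cast at h
    split_ifs at h with h1 h2 h2
    · linarith
    · linarith
    · linarith
    · rcases not_and_or.1 h1 with h | h <;> linarith
  · exact hF

lemma websterFloor_succ_of_Egamma_eq_neg_one {α β γ : ℝ} (hα : 0 < α) (hβ : 0 < β) (hγ : 0 < γ)
    (hαi : Irrational α) (hβi : Irrational β)
    (hsum : α + β + γ = 1) (hβhalf : β < 1 / 2) (hαγ : α < γ) {m : ℕ}
    (hE : Egamma α β γ (m + 1) = -1) :
    websterFloor γ (m + 1) = websterFloor γ m + 1 := by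
  have h := Egamma_eq hα hβ hγ hαi hβi hsum hβhalf hαγ (m + 1)
  have u0 := fpart_nonneg α (m + 1)
  have u1 := fpart_lt_one α (m + 1)
  have v0 := fpart_nonneg β (m + 1)
  have v1 := fpart_lt_one β (m + 1)
  have w0 := fpart_nonneg γ m
  have w0' := fpart_nonneg γ (m + 1)
  rcases websterFloor_succ hγ (by linarith) m with ⟨-, hw⟩ | ⟨hF, -⟩
  · rw [hE] at h
    unfold betaError at h
    push_cast at h
    split_ifs at h with h1 h2 h2
    · linarith
    · linarith
    · linarith
    · rcases not_and_or.1 h2 with h | h <;> linarith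
  · exact hF

lemma WtC_infinite {α β γ : ℝ} (hα : 0 < α) (hβ : 0 < β) (hγ : 0 < γ)
    (hαi : Irrational α) (hβi : Irrational β)
    (hsum : α + β + γ = 1) (hβhalf : β < 1 / 2) (hαγ : α < γ) : (WtC α β).Infinite := by
  intro hfin
  obtain ⟨N, hN⟩ := exists_nat_gt ((((WtC α β).ncard : ℝ) + 2) / γ)
  rw [div_lt_iff₀ hγ] at hN
  have hF : ((WtC α β).ncard : ℤ) + 2 ≤ websterFloor γ N := by
    rw [websterFloor, Int.le_floor]; push_cast; linarith
  have hE := (Egamma_bounds hα hβ hγ hαi hβi hsum hβhalf hαγ N).1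
  rw [Egamma, wCount_wSet hγ (by linarith)] at hE
  have hle : wCount (WtC α β) N ≤ (WtC α β).ncard :=
    Set.ncard_le_ncard Set.inter_subset_left hfin
  omega

lemma nthElt_mem {S : Set ℕ} (hS : S.Infinite) (n : ℕ) : nthElt S n ∈ S :=
  Nat.nth_mem_of_infinite hS _

lemma wCount_nthElt {S : Set ℕ} (hS : S.Infinite) {n : ℕ} (hn : 1 ≤ n) :
    wCount S (nthElt S n) = n := by
  classical
  rw [wCount_eq_count, Nat.count_succ, if_pos (nthElt_mem hS n), nthElt,
    Nat.count_nth_of_infinite (p := (· ∈ S)) hS]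
  omega

/-- Characterization of the perturbation error `c(n) − c̃(n)` in terms of
`E_γ` and membership of `m = c̃(n)` in `W̃_γ` and `W_γ`. -/
theorem c_error_characterization (α β γ : ℝ)
    (hα : 0 < α) (hβ : 0 < β) (hγ : 0 < γ)
    (hαi : Irrational α) (hβi : Irrational β) (hγi : Irrational γ)
    (hsum : α + β + γ = 1) (hβhalf : β < 1/2) (hαγ : α < γ) :
    ∀ n : ℕ, 1 ≤ n →
      ∀ m : ℕ, m = nthElt (WtC α β) n →
        ((wTerm γ n : ℤ) - (m : ℤ) = -1 ∨ (wTerm γ n : ℤ) - (m : ℤ) = 0 ∨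
          (wTerm γ n : ℤ) - (m : ℤ) = 1) ∧
        ((wTerm γ n : ℤ) - (m : ℤ) = -1 ↔
          (m ∈ WtC α β ∧ (Egamma α β γ m = -1 ∨
            (Egamma α β γ m = 0 ∧ m ∉ wSet γ)))) ∧
        ((wTerm γ n : ℤ) - (m : ℤ) = 0 ↔
          (m ∈ WtC α β ∧ Egamma α β γ m = 0 ∧ m ∈ wSet γ)) ∧
        ((wTerm γ n : ℤ) - (m : ℤ) = 1 ↔
          (m ∈ WtC α β ∧ Egamma α β γ m = 1)) := by
  intro n hn m hm
  have hinf := WtC_infinite hα hβ hγ hαi hβi hsum hβhalf hαγ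
  have hγ1 : γ < 1 := by linarith
  have hmem : m ∈ WtC α β := hm ▸ nthElt_mem hinf n
  have hcount : wCount (WtC α β) m = n := hm ▸ wCount_nthElt hinf hn
  obtain ⟨k, rfl⟩ : ∃ k, m = k + 1 :=
    Nat.exists_eq_add_of_le' hmem.1
  clear hm
  have hprev : wCount (WtC α β) (k + 1) = wCount (WtC α β) k + 1 := by
    rw [wCount_succ, if_pos hmem]
  have hE' (j : ℕ) : Egamma α β γ j = wCount (WtC α β) j - websterFloor γ j := by
    rw [Egamma, wCount_wSet hγ hγ1]
  have hb := Egamma_bounds hα hβ hγ hαi hβi hsum hβhalf hαγ k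
  have hb' := Egamma_bounds hα hβ hγ hαi hβi hsum hβhalf hαγ (k + 1)
  have hw := succ_mem_wSet_iff hγ hγ1 k
  have hstep : websterFloor γ (k + 1) = websterFloor γ k ∨
      websterFloor γ (k + 1) = websterFloor γ k + 1 :=
    (websterFloor_succ hγ hγ1 k).imp And.left And.left
  have hup : Egamma α β γ (k + 1) = 1 → wTerm γ n = k + 2 := by
    intro h
    have := websterFloor_succ_of_Egamma_eq_one hα hβ hγ hαi hβi hsum hβhalf hαγ h
    have e := hE' (k + 1)
    exact (wTerm_eq_succ_iff hγ n (k + 1)).2 (by omega)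
  have hmid : Egamma α β γ k = 0 → websterFloor γ (k + 1) = websterFloor γ k + 1 →
      wTerm γ n = k + 1 := by
    intro h h'
    have e := hE' k
    exact (wTerm_eq_succ_iff hγ n k).2 (by omega)
  have hdown : Egamma α β γ k = -1 → wTerm γ n = k := by
    intro h
    have e := hE' k
    cases k with
    | zero => simp [wCount_zero (zero_notMem_WtC α β), websterFloor_zero, h] at e
    | succ j =>
      have := websterFloor_succ_of_Egamma_eq_neg_one hα hβ hγ hαi hβi hsum hβhalf hαγ h
      exact (wTerm_eq_succ_iff hγ n j).2 (by omega)
  have e := hE' k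
  have e' := hE' (k + 1)
  simp only [hmem, hw, true_and]
  push_cast
  have hcases : (Egamma α β γ (k + 1) = 1 ∧ wTerm γ n = k + 2) ∨
      (Egamma α β γ (k + 1) = 0 ∧ websterFloor γ (k + 1) = websterFloor γ k + 1 ∧
        wTerm γ n = k + 1) ∨
      ((Egamma α β γ (k + 1) = -1 ∨ Egamma α β γ (k + 1) = 0 ∧
        websterFloor γ (k + 1) = websterFloor γ k) ∧ wTerm γ n = k) := by
    omega
  omega
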